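/- Let k ≥ 2, let G be a 3-γ-vertex-critical graph that is K_{1,k}-free, and let S ⊆ V(G) be a set such that G − S has at least k + 2 odd components. Then for every vertex x ∈ V(G), every dominating set of G − x of cardinality 2 is contained in S. -/

import Mathlib

open SimpleGraph

/-- `D` is a dominating set of `G`: every vertex is in `D` or adjacent to a vertex of `D`. -/
def IsDomSet {V : Type*} (G : SimpleGraph V) (D : Set V) : Prop :=
  ∀ v, v ∈ D ∨ ∃ u ∈ D, G.Adj u v

/-- The domination number `γ(G)`. -/
noncomputable def domNum {V : Type*} (G : SimpleGraph V) : ℕ :=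
  sInf {n | ∃ D : Set V, IsDomSet G D ∧ D.ncard = n}

/-- `D` is a dominating set of the vertex-deleted graph `G - x`. -/
def IsDomSetAvoiding {V : Type*} (G : SimpleGraph V) (x : V) (D : Set V) : Prop :=
  x ∉ D ∧ ∀ v, v ≠ x → v ∈ D ∨ ∃ u ∈ D, G.Adj u v

/-- The domination number of the vertex-deleted graph `G - x`. -/
noncomputable def domNumDel {V : Type*} (G : SimpleGraph V) (x : V) : ℕ :=
  sInf {n | ∃ D : Set V, IsDomSetAvoiding G x D ∧ D.ncard = n}

/-- `G` is `k`-`γ`-vertex-critical: `γ(G) = k` and `γ(G - v) < k` for every vertex `v`. -/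
def GammaCritical {V : Type*} (G : SimpleGraph V) (k : ℕ) : Prop :=
  domNum G = k ∧ ∀ v : V, domNumDel G v < k

/-- `G` is `K_{1,n}`-free: it has no induced subgraph isomorphic to the star `K_{1,n}`. -/
def StarFree {V : Type*} (G : SimpleGraph V) (n : ℕ) : Prop :=
  ¬ ∃ (c : V) (T : Finset V), T.card = n ∧ (∀ t ∈ T, G.Adj c t) ∧
      ∀ t ∈ T, ∀ t' ∈ T, t ≠ t' → ¬ G.Adj t t'

/-- `G` has a perfect matching. -/
def HasPerfectMatching {V : Type*} (G : SimpleGraph V) : Prop :=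
  ∃ M : G.Subgraph, M.IsPerfectMatching

/-- `G` has a near perfect matching: a matching covering all but exactly one vertex. -/
def HasNearPerfectMatching {V : Type*} (G : SimpleGraph V) : Prop :=
  ∃ (M : G.Subgraph) (v : V), M.IsMatching ∧ M.verts = {v}ᶜ

/-- `c_o(G - S)`: the number of odd components of `G - S`. -/
noncomputable def numOddComponents {V : Type*} (G : SimpleGraph V) (S : Set V) : ℕ :=
  Nat.card {c : (G.induce Sᶜ).ConnectedComponent // Odd c.supp.ncard}

/-- Representatives of distinct components of `G - S` are pairwise non-adjacent, and a vertex
outside `S` is equal or adjacent to at most one of them. -/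
lemma exists_component_representatives {V : Type*} [Fintype V] (G : SimpleGraph V) (S : Set V) :
    ∃ R : Finset V, numOddComponents G S ≤ R.card ∧
      (∀ t ∈ R, ∀ t' ∈ R, t ≠ t' → ¬ G.Adj t t') ∧
      ∀ d ∉ S, ∃ r, ∀ t ∈ R, t ≠ r → t ≠ d ∧ ¬ G.Adj d t := by
  classical
  let H := G.induce Sᶜ
  let rep : H.ConnectedComponent → V := fun c => (Quot.out c).1
  have mk_out (c : H.ConnectedComponent) : H.connectedComponentMk (Quot.out c) = c :=
    Quot.out_eq c
  have rep_inj : Function.Injective rep := by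
    intro c c' h
    rw [← mk_out c, ← mk_out c', Subtype.ext h]
  let R : Finset V := (Finset.univ : Finset {c : H.ConnectedComponent // Odd c.supp.ncard}).image
    fun c => rep c.1
  have mem_R (t : V) (ht : t ∈ R) : ∃ c, rep c = t := by
    obtain ⟨c, -, rfl⟩ := Finset.mem_image.1 ht
    exact ⟨c.1, rfl⟩
  have separated (d : V) (hd : d ∉ S) (c : H.ConnectedComponent)
      (hc : c ≠ H.connectedComponentMk ⟨d, hd⟩) : rep c ≠ d ∧ ¬ G.Adj d (rep c) := by
    refine ⟨fun h => hc ?_, fun h => hc ?_⟩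
    · rw [← mk_out c]
      exact congrArg _ (Subtype.ext h)
    · rw [← mk_out c]
      have hadj : H.Adj (Quot.out c) ⟨d, hd⟩ := h.symm
      exact ConnectedComponent.sound hadj.reachable
  refine ⟨R, ?_, ?_, ?_⟩
  · have hR : R.card = Fintype.card {c : H.ConnectedComponent // Odd c.supp.ncard} :=
      Finset.card_image_of_injective _ (rep_inj.comp Subtype.val_injective)
    rw [hR, ← Nat.card_eq_fintype_card]
    rfl
  · intro t ht t' ht' hne
    obtain ⟨c, rfl⟩ := mem_R t ht
    obtain ⟨c', rfl⟩ := mem_R t' ht'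
    refine (separated _ (Quot.out c).2 c' fun h => hne ?_).2
    rw [h]
    exact congrArg rep (mk_out c).symm
  · intro d hd
    refine ⟨rep (H.connectedComponentMk ⟨d, hd⟩), fun t ht hne => ?_⟩
    obtain ⟨c, rfl⟩ := mem_R t ht
    exact separated d hd c fun h => hne (congrArg rep h)

lemma StarFree.mem_of_isDomSetAvoiding_pair {V : Type*} [Fintype V] {G : SimpleGraph V} {k : ℕ}
    (hk : 2 ≤ k) (hfree : StarFree G k) {S : Set V} (hodd : k + 2 ≤ numOddComponents G S)
    {x d e : V} (hD : IsDomSetAvoiding G x {d, e}) : d ∈ S := by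
  classical
  by_contra hd
  obtain ⟨R, hcard, hind, hsep⟩ := exists_component_representatives G S
  obtain ⟨r, hr⟩ := hsep d hd
  have hle : k ≤ ((R.erase x).erase r).card := by
    have h₁ := Finset.pred_card_le_card_erase (s := R) (a := x)
    have h₂ := Finset.pred_card_le_card_erase (s := R.erase x) (a := r)
    omega
  obtain ⟨T, hT, hTk⟩ := Finset.exists_subset_card_eq hle
  have hTR (t : V) (ht : t ∈ T) : t ≠ r ∧ t ≠ x ∧ t ∈ R := by
    simpa only [Finset.mem_erase] using hT ht
  have hdom (t : V) (ht : t ∈ T) : t = e ∨ G.Adj e t := by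
    obtain ⟨htr, htx, htR⟩ := hTR t ht
    obtain ⟨htd, hnadj⟩ := hr t htR htr
    simpa [htd, hnadj] using hD.2 t htx
  have hTind (t : V) (ht : t ∈ T) (t' : V) (ht' : t' ∈ T) (hne : t ≠ t') : ¬ G.Adj t t' :=
    hind t (hTR t ht).2.2 t' (hTR t' ht').2.2 hne
  by_cases he : e ∈ T
  · obtain ⟨t, ht, hte⟩ := Finset.exists_mem_ne (by omega : 1 < T.card) e
    exact hTind e he t ht hte.symm ((hdom t ht).resolve_left hte)
  · exact hfree ⟨e, T, hTk, fun t ht => (hdom t ht).resolve_left fun h => he (h ▸ ht), hTind⟩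

/-- let `k ≥ 2`, let `G` be `3`-`γ`-vertex-critical and `K_{1,k}`-free, and
let `S` be a vertex set such that `G - S` has at least `k + 2` odd components. Then for
every vertex `x`, every dominating set of `G - x` of cardinality two is contained in
`S`. -/
theorem starFree_many_odd_components_domsets_inside
    {V : Type*} [Fintype V] (G : SimpleGraph V) (k : ℕ) (hk : 2 ≤ k)
    (hcrit : GammaCritical G 3) (hfree : StarFree G k) (S : Set V)
    (hodd : k + 2 ≤ numOddComponents G S) :
    ∀ x : V, ∀ D : Set V, IsDomSetAvoiding G x D → D.ncard = 2 → D ⊆ S := by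
  intro x D hD hcard
  obtain ⟨a, b, -, rfl⟩ := Set.ncard_eq_two.1 hcard
  have ha := hfree.mem_of_isDomSetAvoiding_pair hk hodd hD
  have hb := hfree.mem_of_isDomSetAvoiding_pair hk hodd (Set.pair_comm a b ▸ hD)
  exact Set.insert_subset ha (Set.singleton_subset_iff.2 hb)
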